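/- Fix row vectors Ψ^{(s)(L,t)} ∈ ℝ^{1 × n_L} and matrices Ψ^{(s,0)(L,t)} ∈ ℝ^{n_0 × n_L} for all L ≥ s > 0 and L > t ≥ 0, and real coefficients Φ_{(s,t):pq} (for L ≥ s > t ≥ 0), Φ_{(s):p} (for L ≥ s > 0), Φ_{(s,t)(t):p} (for L ≥ s > t > 0), Φ_{(s)(L,t):pq} and Φ_{(s,0)(L,t):pq} (for L ≥ s > 0, L > t ≥ 0), and Φ_1 ∈ ℝ. Define I(U) := Σ_{L≥s>t≥0} Σ_{p,q} Φ_{(s,t):pq}·[W]^(s,t)_{pq} + Σ_{L≥s>0} Σ_p Φ_{(s):p}·b^(s)_p + Σ_{L≥s>t>0} Σ_p Φ_{(s,t)(t):p}·([W]^(s,t)·b^(t))_p + Σ_{L≥s>0, L>t≥0} Σ_{p,q} Φ_{(s)(L,t):pq}·(b^(s)·Ψ^{(s)(L,t)}·[W]^(L,t))_{pq} + Σ_{L≥s>0, L>t≥0} Σ_{p,q} Φ_{(s,0)(L,t):pq}·([W]^(s,0)·Ψ^{(s,0)(L,t)}·[W]^(L,t))_{pq} + Φ_1. If I(gU) = I(U)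 for every g ∈ G and every weight-space element U, then there exist real coefficients A_{pq}, B_{pq}, C_{pq} (1 ≤ p ≤ n_L, 1 ≤ q ≤ n_0), c_s (L > s > 0), D_{t,p} (L > t > 0, 1 ≤ p ≤ n_L), e_t (L > t > 0), F_p (1 ≤ p ≤ n_L), and φ_1 ∈ ℝ such that for all U, I(U) = Σ_{p,q} A_{pq}·([W]^(L,0)·Ψ^{(L,0)(L,0)}·[W]^(L,0))_{pq} + Σ_{p,q} B_{pq}·[W]^(L,0)_{pq} + Σ_{L>s>0} c_s·Σ_p ([W]^(s,0)·Ψ^{(s,0)(L,s)}·[W]^(L,s))_{pp} + Σ_{p,q} C_{pq}·(b^(L)·Ψ^{(L)(L,0)}·[W]^(L,0))_{pq} + Σ_{L>t>0} Σ_p D_{t,p}·([W]^(L,t)·b^(t))_p + Σ_{L>t>0} e_t·Σ_p (b^(t)·Ψ^{(t)(L,t)}·[W]^(L,t))_{pp} + Σ_p F_p·b^(L)_p + φ_1. -/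

import Mathlib

open Matrix

noncomputable section

/-- The product `[W]^(s,t) = W^(s) * W^(s-1) * ⋯ * W^(t+1)` of `s - t` weight matrices. -/
def Wprod (n : ℕ → ℕ) (W : ∀ i : ℕ, Matrix (Fin (n i)) (Fin (n (i - 1))) ℝ) :
    (s : ℕ) → (t : ℕ) → Matrix (Fin (n s)) (Fin (n t)) ℝ
  | s, t =>
    if _h : t < s then W s * Wprod n W (s - 1) t
    else Matrix.of fun i j => if (i : ℕ) = (j : ℕ) then (1 : ℝ) else 0
termination_by s t => s
decreasing_by omega

/-- The group `G`: tuples `g = (g^(L), …, g^(0))` of invertible matrices with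
`g^(L) = I`, `g^(0) = I`, and `g^(i)` a product of a positive diagonal matrix and a
permutation matrix for `0 < i < L`. -/
def IsInG (L : ℕ) (n : ℕ → ℕ) (g : ∀ i : ℕ, GL (Fin (n i)) ℝ) : Prop :=
  ((g L : Matrix (Fin (n L)) (Fin (n L)) ℝ) = 1) ∧
  ((g 0 : Matrix (Fin (n 0)) (Fin (n 0)) ℝ) = 1) ∧
  ∀ i : ℕ, 0 < i → i < L →
    ∃ (d : Fin (n i) → ℝ) (π : Equiv.Perm (Fin (n i))),
      (∀ j, 0 < d j) ∧
      (g i : Matrix (Fin (n i)) (Fin (n i)) ℝ) = Matrix.diagonal d * π.permMatrix ℝ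

/-- The action of `g` on the weights: `[gW]^(i) = g^(i) · W^(i) · (g^(i-1))⁻¹`. -/
def actW (n : ℕ → ℕ) (g : ∀ i : ℕ, GL (Fin (n i)) ℝ)
    (W : ∀ i : ℕ, Matrix (Fin (n i)) (Fin (n (i - 1))) ℝ) (i : ℕ) :
    Matrix (Fin (n i)) (Fin (n (i - 1))) ℝ :=
  (g i : Matrix (Fin (n i)) (Fin (n i)) ℝ) * W i *
    (((g (i - 1))⁻¹ : GL (Fin (n (i - 1))) ℝ) : Matrix (Fin (n (i - 1))) (Fin (n (i - 1))) ℝ)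

/-- The action of `g` on the biases: `[gb]^(i) = g^(i) · b^(i)`. -/
def actb (n : ℕ → ℕ) (g : ∀ i : ℕ, GL (Fin (n i)) ℝ)
    (b : ∀ i : ℕ, Matrix (Fin (n i)) (Fin 1) ℝ) (i : ℕ) : Matrix (Fin (n i)) (Fin 1) ℝ :=
  (g i : Matrix (Fin (n i)) (Fin (n i)) ℝ) * b i

/-- The general linear combination `I(U)` of all stable polynomial terms. -/
def Ifull (L : ℕ) (n : ℕ → ℕ)
    (Ψb : ∀ _s _t : ℕ, Matrix (Fin 1) (Fin (n L)) ℝ)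
    (ΨW : ∀ _s _t : ℕ, Matrix (Fin (n 0)) (Fin (n L)) ℝ)
    (Φst : ∀ s t : ℕ, Fin (n s) → Fin (n t) → ℝ)
    (Φb : ∀ s : ℕ, Fin (n s) → ℝ)
    (ΦWb : ∀ s _t : ℕ, Fin (n s) → ℝ)
    (ΦbW : ∀ s t : ℕ, Fin (n s) → Fin (n t) → ℝ)
    (ΦWW : ∀ s t : ℕ, Fin (n s) → Fin (n t) → ℝ)
    (Φ1 : ℝ)
    (W : ∀ i : ℕ, Matrix (Fin (n i)) (Fin (n (i - 1))) ℝ)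
    (b : ∀ i : ℕ, Matrix (Fin (n i)) (Fin 1) ℝ) : ℝ :=
  (∑ s ∈ Finset.Icc 1 L, ∑ t ∈ Finset.range s, ∑ p, ∑ q,
      Φst s t p q * (Wprod n W s t) p q)
  + (∑ s ∈ Finset.Icc 1 L, ∑ p, Φb s p * b s p 0)
  + (∑ s ∈ Finset.Icc 1 L, ∑ t ∈ Finset.Ioo 0 s, ∑ p,
      ΦWb s t p * (Wprod n W s t * b t) p 0)
  + (∑ s ∈ Finset.Icc 1 L, ∑ t ∈ Finset.range L, ∑ p, ∑ q,
      ΦbW s t p q * (b s * Ψb s t * Wprod n W L t) p q)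
  + (∑ s ∈ Finset.Icc 1 L, ∑ t ∈ Finset.range L, ∑ p, ∑ q,
      ΦWW s t p q * (Wprod n W s 0 * ΨW s t * Wprod n W L t) p q)
  + Φ1

/-- The reduced form of the invariant layer. -/
def Ired (L : ℕ) (n : ℕ → ℕ)
    (Ψ0 : Matrix (Fin (n 0)) (Fin (n L)) ℝ)
    (Ψs : ∀ _s : ℕ, Matrix (Fin (n 0)) (Fin (n L)) ℝ)
    (Ψ'0 : Matrix (Fin 1) (Fin (n L)) ℝ)
    (Ψ't : ∀ _t : ℕ, Matrix (Fin 1) (Fin (n L)) ℝ)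
    (A B C : Fin (n L) → Fin (n 0) → ℝ)
    (c : ℕ → ℝ) (D : ∀ _t : ℕ, Fin (n L) → ℝ) (e : ℕ → ℝ)
    (F : Fin (n L) → ℝ) (φ1 : ℝ)
    (W : ∀ i : ℕ, Matrix (Fin (n i)) (Fin (n (i - 1))) ℝ)
    (b : ∀ i : ℕ, Matrix (Fin (n i)) (Fin 1) ℝ) : ℝ :=
  (∑ p, ∑ q, A p q * (Wprod n W L 0 * Ψ0 * Wprod n W L 0) p q)
  + (∑ p, ∑ q, B p q * (Wprod n W L 0) p q)
  + (∑ s ∈ Finset.Ioo 0 L, c s * ∑ p, (Wprod n W s 0 * Ψs s * Wprod n W L s) p p)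
  + (∑ p, ∑ q, C p q * (b L * Ψ'0 * Wprod n W L 0) p q)
  + (∑ t ∈ Finset.Ioo 0 L, ∑ p, D t p * (Wprod n W L t * b t) p 0)
  + (∑ t ∈ Finset.Ioo 0 L, e t * ∑ p, (b t * Ψ't t * Wprod n W L t) p p)
  + (∑ p, F p * b L p 0) + φ1

lemma Wprod_self (n : ℕ → ℕ) (W : ∀ i : ℕ, Matrix (Fin (n i)) (Fin (n (i - 1))) ℝ) (t : ℕ) :
    Wprod n W t t = 1 := by
  rw [Wprod, dif_neg (lt_irrefl t)]
  ext i j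
  simp [Matrix.one_apply, Fin.ext_iff]

lemma Wprod_of_lt (n : ℕ → ℕ) (W : ∀ i : ℕ, Matrix (Fin (n i)) (Fin (n (i - 1))) ℝ)
    {s t : ℕ} (h : t < s) : Wprod n W s t = W s * Wprod n W (s - 1) t := by
  rw [Wprod, dif_pos h]

lemma Matrix.GeneralLinearGroup.mul_inv_mul_mul_cancel {k l : ℕ} {α : Type*}
    (B : GL (Fin l) ℝ) (M : Matrix (Fin k) (Fin l) ℝ) (N : Matrix (Fin l) α ℝ) :
    M * B⁻¹.val * (B.val * N) = M * N := by
  have h : B⁻¹.val * B.val = 1 := Units.inv_mul B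
  rw [Matrix.mul_assoc, ← Matrix.mul_assoc _ B.val, h, Matrix.one_mul]

lemma Wprod_actW (n : ℕ → ℕ) (g : ∀ i : ℕ, GL (Fin (n i)) ℝ)
    (W : ∀ i : ℕ, Matrix (Fin (n i)) (Fin (n (i - 1))) ℝ) {s t : ℕ} (h : t ≤ s) :
    Wprod n (actW n g W) s t = (g s).val * Wprod n W s t * (g t)⁻¹.val := by
  induction s, h using Nat.le_induction with
  | base => simp [Wprod_self]
  | succ s hs ih =>
    have ih' : Wprod n (actW n g W) (s + 1 - 1) t
        = (g (s + 1 - 1)).val * (Wprod n W (s + 1 - 1) t * (g t)⁻¹.val) :=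
      ih.trans (Matrix.mul_assoc _ _ _)
    rw [Wprod_of_lt n _ (Nat.lt_succ_of_le hs), Wprod_of_lt n _ (Nat.lt_succ_of_le hs), ih', actW,
      Matrix.GeneralLinearGroup.mul_inv_mul_mul_cancel]
    simp only [Matrix.mul_assoc]

lemma Wprod_mul_bias_act (n : ℕ → ℕ) (g : ∀ i : ℕ, GL (Fin (n i)) ℝ)
    (W : ∀ i : ℕ, Matrix (Fin (n i)) (Fin (n (i - 1))) ℝ)
    (b : ∀ i : ℕ, Matrix (Fin (n i)) (Fin 1) ℝ) {s t : ℕ} (h : t ≤ s) :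
    Wprod n (actW n g W) s t * actb n g b t = (g s).val * (Wprod n W s t * b t) := by
  rw [Wprod_actW n g W h, actb, Matrix.GeneralLinearGroup.mul_inv_mul_mul_cancel,
    Matrix.mul_assoc]

lemma bias_mul_Wprod_act {L : ℕ} (n : ℕ → ℕ) (g : ∀ i : ℕ, GL (Fin (n i)) ℝ)
    (hgL : (g L).val = 1) (W : ∀ i : ℕ, Matrix (Fin (n i)) (Fin (n (i - 1))) ℝ)
    (b : ∀ i : ℕ, Matrix (Fin (n i)) (Fin 1) ℝ) (Ψ : Matrix (Fin 1) (Fin (n L)) ℝ)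
    {s t : ℕ} (h : t ≤ L) :
    actb n g b s * Ψ * Wprod n (actW n g W) L t
      = (g s).val * (b s * Ψ * Wprod n W L t) * (g t)⁻¹.val := by
  rw [Wprod_actW n g W h, hgL, actb]
  simp only [Matrix.mul_assoc, Matrix.one_mul]

lemma Wprod_mul_Wprod_act {L : ℕ} (n : ℕ → ℕ) (g : ∀ i : ℕ, GL (Fin (n i)) ℝ)
    (hgL : (g L).val = 1) (hg0 : (g 0).val = 1)
    (W : ∀ i : ℕ, Matrix (Fin (n i)) (Fin (n (i - 1))) ℝ)
    (Ψ : Matrix (Fin (n 0)) (Fin (n L)) ℝ) {s t : ℕ} (h : t ≤ L) :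
    Wprod n (actW n g W) s 0 * Ψ * Wprod n (actW n g W) L t
      = (g s).val * (Wprod n W s 0 * Ψ * Wprod n W L t) * (g t)⁻¹.val := by
  have hg0' : g 0 = 1 := Units.ext hg0
  rw [Wprod_actW n g W h, Wprod_actW n g W (Nat.zero_le s), hgL, hg0']
  simp [Matrix.mul_assoc]

/-- On the positive reals, `f` is a Laurent polynomial with constant coefficient `z`. -/
def HasConstantCoeff (f : ℝ → ℝ) (z : ℝ) : Prop :=
  ∃ (N : ℕ) (p : Polynomial ℝ), p.coeff N = z ∧ ∀ x : ℝ, 0 < x → f x * x ^ N = p.eval x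

namespace HasConstantCoeff

lemma add {f f' : ℝ → ℝ} {z z' : ℝ} (h : HasConstantCoeff f z) (h' : HasConstantCoeff f' z') :
    HasConstantCoeff (fun x => f x + f' x) (z + z') := by
  obtain ⟨N, p, hp, hf⟩ := h
  obtain ⟨N', p', hp', hf'⟩ := h'
  refine ⟨N + N', p * Polynomial.X ^ N' + p' * Polynomial.X ^ N, ?_, fun x hx => ?_⟩
  · rw [Polynomial.coeff_add, Polynomial.coeff_mul_X_pow, add_comm N N',
      Polynomial.coeff_mul_X_pow, hp, hp']
  · simp only [Polynomial.eval_add, Polynomial.eval_mul, Polynomial.eval_pow,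
      Polynomial.eval_X, ← hf x hx, ← hf' x hx]
    ring

lemma const (c : ℝ) : HasConstantCoeff (fun _ => c) c :=
  ⟨0, Polynomial.C c, by simp, by simp⟩

lemma sum {ι : Type*} (S : Finset ι) {f : ι → ℝ → ℝ} {z : ι → ℝ}
    (h : ∀ i ∈ S, HasConstantCoeff (f i) (z i)) :
    HasConstantCoeff (fun x => ∑ i ∈ S, f i x) (∑ i ∈ S, z i) := by
  classical
  induction S using Finset.induction_on with
  | empty => simpa using const 0
  | insert i S hi ih =>
    simp only [Finset.sum_insert hi]
    exact (h i (Finset.mem_insert_self i S)).add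
      (ih fun j hj => h j (Finset.mem_insert_of_mem hj))

lemma monomial (k l : ℕ) (c : ℝ) :
    HasConstantCoeff (fun x => c * (x ^ k * (x ^ l)⁻¹)) (if k = l then c else 0) := by
  refine ⟨l, Polynomial.C c * Polynomial.X ^ k, ?_, fun x hx => ?_⟩
  · simp [Polynomial.coeff_X_pow, eq_comm]
  · have : x ^ l ≠ 0 := by positivity
    simp only [Polynomial.eval_mul, Polynomial.eval_C, Polynomial.eval_pow, Polynomial.eval_X]
    field_simp

lemma monomial_pow (k : ℕ) (c : ℝ) :
    HasConstantCoeff (fun x => c * x ^ k) (if k = 0 then c else 0) := by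
  simpa using monomial k 0 c

lemma eq_of_forall_eq {f : ℝ → ℝ} {y z : ℝ} (h : HasConstantCoeff f z)
    (hf : ∀ x, 0 < x → f x = y) : y = z := by
  obtain ⟨N, p, hp, hpf⟩ := h
  have : p = Polynomial.C y * Polynomial.X ^ N := by
    refine Polynomial.eq_of_infinite_eval_eq _ _ ((Set.Ioi_infinite (0 : ℝ)).mono fun x hx => ?_)
    simp [← hpf x hx, hf x hx]
  rw [← hp, this]
  simp

end HasConstantCoeff

/-- Exponents on the neurons, vanishing at the outer layers and separating all hidden neurons. -/
def weight (L i j : ℕ) : ℕ := if 0 < i ∧ i < L then Nat.pair i j else 0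

lemma weight_zero (L j : ℕ) : weight L 0 j = 0 := by simp [weight]

lemma weight_last (L j : ℕ) : weight L L j = 0 := by simp [weight]

lemma weight_hidden_ne_zero {L i : ℕ} (hi : i ∈ Finset.Ioo 0 L) (j : ℕ) : weight L i j ≠ 0 := by
  rw [Finset.mem_Ioo] at hi
  rw [weight, if_pos hi]
  have := Nat.left_le_pair i j
  omega

lemma weight_hidden_eq_iff {L i i' : ℕ} (hi : i ∈ Finset.Ioo 0 L) (hi' : i' ∈ Finset.Ioo 0 L)
    (j j' : ℕ) : weight L i j = weight L i' j' ↔ i = i' ∧ j = j' := by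
  rw [Finset.mem_Ioo] at hi hi'
  rw [weight, weight, if_pos hi, if_pos hi', Nat.pair_eq_pair]

/-- The invertible diagonal matrix with entries `x ^ k j`. -/
def powDiagonal {m : ℕ} (k : Fin m → ℕ) (x : ℝ) (hx : 0 < x) : GL (Fin m) ℝ where
  val := diagonal fun j => x ^ k j
  inv := diagonal fun j => (x ^ k j)⁻¹
  val_inv := by
    rw [diagonal_mul_diagonal, ← diagonal_one]
    congr 1; ext j
    exact mul_inv_cancel₀ (by positivity)
  inv_val := by
    rw [diagonal_mul_diagonal, ← diagonal_one]
    congr 1; ext j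
    exact inv_mul_cancel₀ (by positivity)

lemma powDiagonal_val {m : ℕ} (k : Fin m → ℕ) (x : ℝ) (hx : 0 < x) :
    (powDiagonal k x hx).val = diagonal fun j => x ^ k j := rfl

lemma powDiagonal_inv_val {m : ℕ} (k : Fin m → ℕ) (x : ℝ) (hx : 0 < x) :
    (powDiagonal k x hx)⁻¹.val = diagonal fun j => (x ^ k j)⁻¹ := rfl

/-- A permutation matrix as an invertible matrix. -/
def permGL {m : ℕ} (π : Equiv.Perm (Fin m)) : GL (Fin m) ℝ where
  val := π.permMatrix ℝ
  inv := π⁻¹.permMatrix ℝ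
  val_inv := by rw [← Matrix.permMatrix_mul]; simp
  inv_val := by rw [← Matrix.permMatrix_mul]; simp

lemma permGL_conj_apply {m : ℕ} (π : Equiv.Perm (Fin m)) (M : Matrix (Fin m) (Fin m) ℝ)
    (p q : Fin m) : ((permGL π).val * M * (permGL π)⁻¹.val) p q = M (π p) (π q) := by
  change ((π.permMatrix ℝ) * M * (π⁻¹.permMatrix ℝ)) p q = _
  rw [Equiv.Perm.permMatrix, Equiv.Perm.permMatrix, PEquiv.toMatrix_toPEquiv_mul,
    PEquiv.mul_toMatrix_toPEquiv]
  rfl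

lemma sum_Icc_one_eq {L : ℕ} (hL : 1 ≤ L) (f : ℕ → ℝ) :
    ∑ s ∈ Finset.Icc 1 L, f s = f L + ∑ s ∈ Finset.Ioo 0 L, f s := by
  rw [← Finset.sum_insert (by simp)]
  congr 1; ext s
  simp only [Finset.mem_Icc, Finset.mem_insert, Finset.mem_Ioo]
  omega

lemma sum_range_eq_Ioo {L : ℕ} (hL : 1 ≤ L) (f : ℕ → ℝ) :
    ∑ t ∈ Finset.range L, f t = f 0 + ∑ t ∈ Finset.Ioo 0 L, f t := by
  rw [← Finset.sum_insert (by simp)]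
  congr 1; ext s
  simp only [Finset.mem_range, Finset.mem_insert, Finset.mem_Ioo]
  omega

lemma sum_weight_eq_zero {L : ℕ} (hL : 1 ≤ L) (n : ℕ → ℕ) (H : ∀ s : ℕ, Fin (n s) → ℝ) :
    ∑ s ∈ Finset.Icc 1 L, ∑ p : Fin (n s), (if weight L s p = 0 then H s p else 0)
      = ∑ p, H L p := by
  rw [sum_Icc_one_eq hL, Finset.sum_eq_zero (s := Finset.Ioo 0 L), add_zero]
  · simp [weight_last]
  · intro s hs
    simp [weight_hidden_ne_zero hs]

lemma sum_weight_eq_of_lt {L : ℕ} (hL : 1 ≤ L) (n : ℕ → ℕ)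
    (H : ∀ s t : ℕ, Fin (n s) → Fin (n t) → ℝ) :
    ∑ s ∈ Finset.Icc 1 L, ∑ t ∈ Finset.range s, ∑ p : Fin (n s), ∑ q : Fin (n t),
      (if weight L s p = weight L t q then H s t p q else 0) = ∑ p, ∑ q, H L 0 p q := by
  rw [sum_Icc_one_eq hL, Finset.sum_eq_zero (s := Finset.Ioo 0 L), add_zero,
    sum_range_eq_Ioo hL, Finset.sum_eq_zero (s := Finset.Ioo 0 L), add_zero]
  · simp [weight_last, weight_zero]
  · intro t ht
    simp [weight_last, (weight_hidden_ne_zero ht _).symm]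
  · intro s hs
    refine Finset.sum_eq_zero fun t ht => Finset.sum_eq_zero fun p _ =>
      Finset.sum_eq_zero fun q _ => if_neg ?_
    rw [Finset.mem_range] at ht
    rcases Nat.eq_zero_or_pos t with rfl | ht0
    · rw [weight_zero]
      exact weight_hidden_ne_zero hs _
    · have ht' : t ∈ Finset.Ioo 0 L := by
        rw [Finset.mem_Ioo] at hs ⊢
        omega
      rw [weight_hidden_eq_iff hs ht']
      omega

lemma sum_weight_eq {L : ℕ} (hL : 1 ≤ L) (n : ℕ → ℕ)
    (H : ∀ s t : ℕ, Fin (n s) → Fin (n t) → ℝ) :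
    ∑ s ∈ Finset.Icc 1 L, ∑ t ∈ Finset.range L, ∑ p : Fin (n s), ∑ q : Fin (n t),
      (if weight L s p = weight L t q then H s t p q else 0)
      = ∑ p, ∑ q, H L 0 p q + ∑ s ∈ Finset.Ioo 0 L, ∑ p, H s s p p := by
  rw [sum_Icc_one_eq hL, sum_range_eq_Ioo hL, Finset.sum_eq_zero (s := Finset.Ioo 0 L), add_zero]
  · congr 1
    · simp [weight_last, weight_zero]
    · refine Finset.sum_congr rfl fun s hs => ?_
      rw [sum_range_eq_Ioo hL, Finset.sum_eq_single_of_mem s hs]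
      · simp [weight_zero, weight_hidden_ne_zero hs, weight_hidden_eq_iff hs hs, ← Fin.ext_iff]
      · intro t ht hts
        simp [weight_hidden_eq_iff hs ht, hts.symm]
  · intro t ht
    simp [weight_last, (weight_hidden_ne_zero ht _).symm]

/-- The contribution of the hidden layer `s` to the rescaling-invariant terms of `Ifull`. -/
def hiddenDiagonal (L : ℕ) (n : ℕ → ℕ)
    (Ψb : ∀ _s _t : ℕ, Matrix (Fin 1) (Fin (n L)) ℝ)
    (ΨW : ∀ _s _t : ℕ, Matrix (Fin (n 0)) (Fin (n L)) ℝ)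
    (ΦbW ΦWW : ∀ s t : ℕ, Fin (n s) → Fin (n t) → ℝ)
    (W : ∀ i : ℕ, Matrix (Fin (n i)) (Fin (n (i - 1))) ℝ)
    (b : ∀ i : ℕ, Matrix (Fin (n i)) (Fin 1) ℝ) (s : ℕ) : ℝ :=
  (∑ p, ΦbW s s p p * (b s * Ψb s s * Wprod n W L s) p p)
    + ∑ p, ΦWW s s p p * (Wprod n W s 0 * ΨW s s * Wprod n W L s) p p

/-- The rescaling-invariant terms whose entries are indexed by neurons of the outer layers. -/
def outerPart (L : ℕ) (n : ℕ → ℕ)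
    (Ψb : ∀ _s _t : ℕ, Matrix (Fin 1) (Fin (n L)) ℝ)
    (ΨW : ∀ _s _t : ℕ, Matrix (Fin (n 0)) (Fin (n L)) ℝ)
    (Φst : ∀ s t : ℕ, Fin (n s) → Fin (n t) → ℝ)
    (Φb : ∀ s : ℕ, Fin (n s) → ℝ)
    (ΦWb : ∀ s _t : ℕ, Fin (n s) → ℝ)
    (ΦbW ΦWW : ∀ s t : ℕ, Fin (n s) → Fin (n t) → ℝ)
    (Φ1 : ℝ)
    (W : ∀ i : ℕ, Matrix (Fin (n i)) (Fin (n (i - 1))) ℝ)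
    (b : ∀ i : ℕ, Matrix (Fin (n i)) (Fin 1) ℝ) : ℝ :=
  (∑ p, ∑ q, Φst L 0 p q * (Wprod n W L 0) p q)
  + (∑ p, Φb L p * b L p 0)
  + (∑ t ∈ Finset.Ioo 0 L, ∑ p, ΦWb L t p * (Wprod n W L t * b t) p 0)
  + (∑ p, ∑ q, ΦbW L 0 p q * (b L * Ψb L 0 * Wprod n W L 0) p q)
  + (∑ p, ∑ q, ΦWW L 0 p q * (Wprod n W L 0 * ΨW L 0 * Wprod n W L 0) p q)
  + Φ1

section Invariance

variable {L : ℕ} (hL : 1 ≤ L) {n : ℕ → ℕ}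
  {Ψb : ∀ _s _t : ℕ, Matrix (Fin 1) (Fin (n L)) ℝ}
  {ΨW : ∀ _s _t : ℕ, Matrix (Fin (n 0)) (Fin (n L)) ℝ}
  {Φst : ∀ s t : ℕ, Fin (n s) → Fin (n t) → ℝ}
  {Φb : ∀ s : ℕ, Fin (n s) → ℝ}
  {ΦWb : ∀ s _t : ℕ, Fin (n s) → ℝ}
  {ΦbW ΦWW : ∀ s t : ℕ, Fin (n s) → Fin (n t) → ℝ}
  {Φ1 : ℝ}
  (hinv : ∀ g : ∀ i : ℕ, GL (Fin (n i)) ℝ, IsInG L n g →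
    ∀ (W : ∀ i : ℕ, Matrix (Fin (n i)) (Fin (n (i - 1))) ℝ)
      (b : ∀ i : ℕ, Matrix (Fin (n i)) (Fin 1) ℝ),
      Ifull L n Ψb ΨW Φst Φb ΦWb ΦbW ΦWW Φ1 (actW n g W) (actb n g b)
        = Ifull L n Ψb ΨW Φst Φb ΦWb ΦbW ΦWW Φ1 W b)

/-- The rescaling of all hidden neurons by powers of `x` with separated exponents. -/
def rescaling (L : ℕ) (n : ℕ → ℕ) (x : ℝ) (hx : 0 < x) (i : ℕ) : GL (Fin (n i)) ℝ :=
  powDiagonal (fun j => weight L i j) x hx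

lemma rescaling_val_last (x : ℝ) (hx : 0 < x) : (rescaling L n x hx L).val = 1 := by
  simp [rescaling, powDiagonal_val, weight_last]

lemma rescaling_val_zero (x : ℝ) (hx : 0 < x) : (rescaling L n x hx 0).val = 1 := by
  simp [rescaling, powDiagonal_val, weight_zero]

lemma isInG_rescaling (x : ℝ) (hx : 0 < x) : IsInG L n (rescaling L n x hx) :=
  ⟨rescaling_val_last x hx, rescaling_val_zero x hx, fun i _ _ =>
    ⟨fun j => x ^ weight L i j, 1, fun _ => by positivity,
      by simp [rescaling, powDiagonal_val]⟩⟩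

lemma rescaling_mul_apply (x : ℝ) (hx : 0 < x) (s : ℕ) (M : Matrix (Fin (n s)) (Fin 1) ℝ)
    (p : Fin (n s)) (q : Fin 1) :
    ((rescaling L n x hx s).val * M) p q = M p q * x ^ weight L s p := by
  rw [rescaling, powDiagonal_val, diagonal_mul, mul_comm]

lemma rescaling_conj_apply (x : ℝ) (hx : 0 < x) (s t : ℕ)
    (M : Matrix (Fin (n s)) (Fin (n t)) ℝ) (p : Fin (n s)) (q : Fin (n t)) :
    ((rescaling L n x hx s).val * M * (rescaling L n x hx t)⁻¹.val) p q
      = M p q * (x ^ weight L s p * (x ^ weight L t q)⁻¹) := by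
  rw [rescaling, rescaling, powDiagonal_val, powDiagonal_inv_val, mul_diagonal, diagonal_mul]
  ring

include hL hinv

lemma Ifull_eq_outerPart_add_hiddenDiagonal
    (W : ∀ i : ℕ, Matrix (Fin (n i)) (Fin (n (i - 1))) ℝ)
    (b : ∀ i : ℕ, Matrix (Fin (n i)) (Fin 1) ℝ) :
    Ifull L n Ψb ΨW Φst Φb ΦWb ΦbW ΦWW Φ1 W b
      = outerPart L n Ψb ΨW Φst Φb ΦWb ΦbW ΦWW Φ1 W b
        + ∑ s ∈ Finset.Ioo 0 L, hiddenDiagonal L n Ψb ΨW ΦbW ΦWW W b s := by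
  have hcoeff := ((((
    (HasConstantCoeff.sum (Finset.Icc 1 L) fun s _ => .sum (Finset.range s) fun t _ =>
      .sum Finset.univ fun p : Fin (n s) => fun _ => .sum Finset.univ fun q : Fin (n t) => fun _ =>
      .monomial (weight L s p) (weight L t q) (Φst s t p q * Wprod n W s t p q)).add
    (.sum (Finset.Icc 1 L) fun s _ => .sum Finset.univ fun p : Fin (n s) => fun _ =>
      .monomial_pow (weight L s p) (Φb s p * b s p 0))).add
    (.sum (Finset.Icc 1 L) fun s _ => .sum (Finset.Ioo 0 s) fun t _ =>
      .sum Finset.univ fun p : Fin (n s) => fun _ =>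
      .monomial_pow (weight L s p) (ΦWb s t p * (Wprod n W s t * b t) p 0))).add
    (.sum (Finset.Icc 1 L) fun s _ => .sum (Finset.range L) fun t _ =>
      .sum Finset.univ fun p : Fin (n s) => fun _ => .sum Finset.univ fun q : Fin (n t) => fun _ =>
      .monomial (weight L s p) (weight L t q)
        (ΦbW s t p q * (b s * Ψb s t * Wprod n W L t) p q))).add
    (.sum (Finset.Icc 1 L) fun s _ => .sum (Finset.range L) fun t _ =>
      .sum Finset.univ fun p : Fin (n s) => fun _ => .sum Finset.univ fun q : Fin (n t) => fun _ =>
      .monomial (weight L s p) (weight L t q)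
        (ΦWW s t p q * (Wprod n W s 0 * ΨW s t * Wprod n W L t) p q))).add
    (.const Φ1)
  rw [hcoeff.eq_of_forall_eq (y := Ifull L n Ψb ΨW Φst Φb ΦWb ΦbW ΦWW Φ1 W b)]
  · rw [sum_weight_eq_of_lt hL n fun s t p q => Φst s t p q * Wprod n W s t p q,
      sum_weight_eq_zero hL n fun s p => Φb s p * b s p 0,
      sum_weight_eq hL n fun s t p q => ΦbW s t p q * (b s * Ψb s t * Wprod n W L t) p q,
      sum_weight_eq hL n fun s t p q =>
        ΦWW s t p q * (Wprod n W s 0 * ΨW s t * Wprod n W L t) p q]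
    have hbias : ∑ s ∈ Finset.Icc 1 L, ∑ t ∈ Finset.Ioo 0 s, ∑ p : Fin (n s),
        (if weight L s p = 0 then ΦWb s t p * (Wprod n W s t * b t) p 0 else 0)
        = ∑ t ∈ Finset.Ioo 0 L, ∑ p, ΦWb L t p * (Wprod n W L t * b t) p 0 := by
      rw [Finset.sum_comm (s := Finset.Ioo 0 L), ← sum_weight_eq_zero hL n fun s p =>
        ∑ t ∈ Finset.Ioo 0 s, ΦWb s t p * (Wprod n W s t * b t) p 0]
      refine Finset.sum_congr rfl fun s _ => ?_
      rw [Finset.sum_comm]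
      refine Finset.sum_congr rfl fun p _ => ?_
      split_ifs <;> simp
    rw [hbias]
    simp only [outerPart, hiddenDiagonal, Finset.sum_add_distrib]
    ring
  · intro x hx
    rw [← hinv _ (isInG_rescaling x hx) W b, Ifull]
    refine congrArg₂ _ (congrArg₂ _ (congrArg₂ _ (congrArg₂ _ (congrArg₂ _ ?_ ?_) ?_) ?_) ?_) rfl
    · refine Finset.sum_congr rfl fun s _ => Finset.sum_congr rfl fun t ht =>
        Finset.sum_congr rfl fun p _ => Finset.sum_congr rfl fun q _ => ?_
      rw [Wprod_actW _ _ _ (Finset.mem_range.1 ht).le, rescaling_conj_apply, mul_assoc]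
    · refine Finset.sum_congr rfl fun s _ => Finset.sum_congr rfl fun p _ => ?_
      rw [actb, rescaling_mul_apply, mul_assoc]
    · refine Finset.sum_congr rfl fun s _ => Finset.sum_congr rfl fun t ht =>
        Finset.sum_congr rfl fun p _ => ?_
      rw [Wprod_mul_bias_act _ _ _ _ (Finset.mem_Ioo.1 ht).2.le, rescaling_mul_apply, mul_assoc]
    · refine Finset.sum_congr rfl fun s _ => Finset.sum_congr rfl fun t ht =>
        Finset.sum_congr rfl fun p _ => Finset.sum_congr rfl fun q _ => ?_
      rw [bias_mul_Wprod_act _ _ (rescaling_val_last x hx) _ _ _ (Finset.mem_range.1 ht).le,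
        rescaling_conj_apply, mul_assoc]
    · refine Finset.sum_congr rfl fun s _ => Finset.sum_congr rfl fun t ht =>
        Finset.sum_congr rfl fun p _ => Finset.sum_congr rfl fun q _ => ?_
      rw [Wprod_mul_Wprod_act _ _ (rescaling_val_last x hx) (rescaling_val_zero x hx) _ _
        (Finset.mem_range.1 ht).le, rescaling_conj_apply, mul_assoc]

/-- Permuting the neurons of one hidden layer does not change the contribution of that layer. -/
lemma hiddenDiagonal_perm (W : ∀ i : ℕ, Matrix (Fin (n i)) (Fin (n (i - 1))) ℝ)
    (b : ∀ i : ℕ, Matrix (Fin (n i)) (Fin 1) ℝ) {s : ℕ} (hs : s ∈ Finset.Ioo 0 L)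
    (π : Equiv.Perm (Fin (n s))) :
    (∑ p, ΦbW s s p p * (b s * Ψb s s * Wprod n W L s) (π p) (π p))
      + ∑ p, ΦWW s s p p * (Wprod n W s 0 * ΨW s s * Wprod n W L s) (π p) (π p)
      = hiddenDiagonal L n Ψb ΨW ΦbW ΦWW W b s := by
  have hs' := Finset.mem_Ioo.1 hs
  set g : ∀ i : ℕ, GL (Fin (n i)) ℝ := Function.update (fun _ => 1) s (permGL π) with hg
  have hgs : g s = permGL π := Function.update_self ..
  have hg_ne : ∀ i, i ≠ s → g i = 1 := fun i hi => Function.update_of_ne hi ..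
  have hgL : (g L).val = 1 := by rw [hg_ne L (by omega)]; rfl
  have hg0 : (g 0).val = 1 := by rw [hg_ne 0 (by omega)]; rfl
  have hG : IsInG L n g := by
    refine ⟨hgL, hg0, fun i _ _ => ?_⟩
    by_cases hi : i = s
    · subst hi
      exact ⟨fun _ => 1, π, fun _ => one_pos, by rw [hgs]; simp [permGL]⟩
    · exact ⟨fun _ => 1, 1, fun _ => one_pos, by rw [hg_ne i hi]; simp⟩
  have hWL0 : Wprod n (actW n g W) L 0 = Wprod n W L 0 := by
    rw [Wprod_actW n g W (Nat.zero_le L), hgL, hg_ne 0 (by omega)]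
    simp
  have hbL : actb n g b L = b L := by rw [actb, hgL, Matrix.one_mul]
  have houter : outerPart L n Ψb ΨW Φst Φb ΦWb ΦbW ΦWW Φ1 (actW n g W) (actb n g b)
      = outerPart L n Ψb ΨW Φst Φb ΦWb ΦbW ΦWW Φ1 W b := by
    have hWb : ∀ t ∈ Finset.Ioo 0 L,
        ∑ p, ΦWb L t p * (Wprod n (actW n g W) L t * actb n g b t) p 0
          = ∑ p, ΦWb L t p * (Wprod n W L t * b t) p 0 := fun t ht => by
      rw [Wprod_mul_bias_act n g W b (Finset.mem_Ioo.1 ht).2.le, hgL, Matrix.one_mul]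
    rw [outerPart, outerPart, hWL0, hbL, Finset.sum_congr rfl hWb]
  have hbW : ∀ t ∈ Finset.Ioo 0 L,
      actb n g b t * Ψb t t * Wprod n (actW n g W) L t
        = (g t).val * (b t * Ψb t t * Wprod n W L t) * (g t)⁻¹.val := fun t ht =>
    bias_mul_Wprod_act n g hgL W b _ (Finset.mem_Ioo.1 ht).2.le
  have hWW : ∀ t ∈ Finset.Ioo 0 L,
      Wprod n (actW n g W) t 0 * ΨW t t * Wprod n (actW n g W) L t
        = (g t).val * (Wprod n W t 0 * ΨW t t * Wprod n W L t) * (g t)⁻¹.val := fun t ht =>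
    Wprod_mul_Wprod_act n g hgL hg0 W _ (Finset.mem_Ioo.1 ht).2.le
  have hrest : ∀ t ∈ (Finset.Ioo 0 L).erase s,
      hiddenDiagonal L n Ψb ΨW ΦbW ΦWW (actW n g W) (actb n g b) t
        = hiddenDiagonal L n Ψb ΨW ΦbW ΦWW W b t := fun t ht => by
    obtain ⟨hts, ht⟩ := Finset.mem_erase.1 ht
    rw [hiddenDiagonal, hbW t ht, hWW t ht, hg_ne t hts]
    simp [hiddenDiagonal]
  have hmain := hinv g hG W b
  rw [Ifull_eq_outerPart_add_hiddenDiagonal hL hinv, Ifull_eq_outerPart_add_hiddenDiagonal hL hinv,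
    houter, ← Finset.add_sum_erase _ _ hs, ← Finset.add_sum_erase _ _ hs,
    Finset.sum_congr rfl hrest] at hmain
  have hlayer : hiddenDiagonal L n Ψb ΨW ΦbW ΦWW (actW n g W) (actb n g b) s
      = hiddenDiagonal L n Ψb ΨW ΦbW ΦWW W b s := by linarith
  rw [← hlayer, hiddenDiagonal, hbW s hs, hWW s hs, hgs]
  simp only [permGL_conj_apply]

lemma hiddenDiagonal_eq_trace (hn : ∀ i, 1 ≤ n i)
    (W : ∀ i : ℕ, Matrix (Fin (n i)) (Fin (n (i - 1))) ℝ)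
    (b : ∀ i : ℕ, Matrix (Fin (n i)) (Fin 1) ℝ) {s : ℕ} (hs : s ∈ Finset.Ioo 0 L) :
    hiddenDiagonal L n Ψb ΨW ΦbW ΦWW W b s
      = (∑ p, ΦbW s s p p) / n s * ∑ p, (b s * Ψb s s * Wprod n W L s) p p
        + (∑ p, ΦWW s s p p) / n s * ∑ p, (Wprod n W s 0 * ΨW s s * Wprod n W L s) p p := by
  have : NeZero (n s) := ⟨by have := hn s; omega⟩
  have hne : (n s : ℝ) ≠ 0 := NeZero.ne _
  have hsum := Finset.sum_congr (rfl : (Finset.univ : Finset (Fin (n s))) = _) fun k _ =>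
    hiddenDiagonal_perm hL hinv W b hs (Equiv.addRight k)
  have hshift : ∀ (φ f : Fin (n s) → ℝ),
      ∑ k, ∑ p, φ p * f (Equiv.addRight k p) = (∑ p, φ p) * ∑ q, f q := fun φ f => by
    rw [Finset.sum_comm, Finset.sum_mul]
    refine Finset.sum_congr rfl fun p _ => ?_
    rw [← Finset.mul_sum, ← Equiv.sum_comp (Equiv.addLeft p) f]
    rfl
  rw [Finset.sum_add_distrib,
    hshift (fun p => ΦbW s s p p) fun q => (b s * Ψb s s * Wprod n W L s) q q,
    hshift (fun p => ΦWW s s p p) fun q => (Wprod n W s 0 * ΨW s s * Wprod n W L s) q q,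
    Finset.sum_const, Finset.card_univ, Fintype.card_fin, nsmul_eq_mul] at hsum
  field_simp
  linarith

end Invariance

/-- if the general linear combination `I` of stable polynomial terms is
`G`-invariant, then it coincides with a reduced-form invariant layer. -/
theorem Ifull_invariant_characterization (L : ℕ) (hL : 1 ≤ L) (n : ℕ → ℕ) (hn : ∀ i, 1 ≤ n i)
    (Ψb : ∀ _s _t : ℕ, Matrix (Fin 1) (Fin (n L)) ℝ)
    (ΨW : ∀ _s _t : ℕ, Matrix (Fin (n 0)) (Fin (n L)) ℝ)
    (Φst : ∀ s t : ℕ, Fin (n s) → Fin (n t) → ℝ)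
    (Φb : ∀ s : ℕ, Fin (n s) → ℝ)
    (ΦWb : ∀ s _t : ℕ, Fin (n s) → ℝ)
    (ΦbW : ∀ s t : ℕ, Fin (n s) → Fin (n t) → ℝ)
    (ΦWW : ∀ s t : ℕ, Fin (n s) → Fin (n t) → ℝ)
    (Φ1 : ℝ)
    (hinv : ∀ g : ∀ i : ℕ, GL (Fin (n i)) ℝ, IsInG L n g →
      ∀ (W : ∀ i : ℕ, Matrix (Fin (n i)) (Fin (n (i - 1))) ℝ)
        (b : ∀ i : ℕ, Matrix (Fin (n i)) (Fin 1) ℝ),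
        Ifull L n Ψb ΨW Φst Φb ΦWb ΦbW ΦWW Φ1 (actW n g W) (actb n g b)
          = Ifull L n Ψb ΨW Φst Φb ΦWb ΦbW ΦWW Φ1 W b) :
    ∃ (A B C : Fin (n L) → Fin (n 0) → ℝ) (c : ℕ → ℝ) (D : ∀ _t : ℕ, Fin (n L) → ℝ)
      (e : ℕ → ℝ) (F : Fin (n L) → ℝ) (φ1 : ℝ),
      ∀ (W : ∀ i : ℕ, Matrix (Fin (n i)) (Fin (n (i - 1))) ℝ)
        (b : ∀ i : ℕ, Matrix (Fin (n i)) (Fin 1) ℝ),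
        Ifull L n Ψb ΨW Φst Φb ΦWb ΦbW ΦWW Φ1 W b
          = Ired L n (ΨW L 0) (fun s => ΨW s s) (Ψb L 0) (fun t => Ψb t t)
              A B C c D e F φ1 W b := by
  refine ⟨ΦWW L 0, Φst L 0, ΦbW L 0, fun s => (∑ p, ΦWW s s p p) / n s, ΦWb L,
    fun t => (∑ p, ΦbW t t p p) / n t, Φb L, Φ1, fun W b => ?_⟩
  rw [Ifull_eq_outerPart_add_hiddenDiagonal hL hinv W b,
    Finset.sum_congr rfl fun s hs => hiddenDiagonal_eq_trace hL hinv hn W b hs,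
    Finset.sum_add_distrib, outerPart, Ired]
  ring
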